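/- arXiv:2304.10584 — 2 statements merged into one kernel-verified Lean document; each statement's English description precedes it below -/
import Mathlib

section
/- Coisotropic relations are closed under relational composition: let k be a field and a, b, c ∈ ℕ. If R is a coisotropic subspace of (k^{2a} × k^{2b}, Ω_{a,b}) and S is a coisotropic subspace of (k^{2b} × k^{2c}, Ω_{b,c}), then the relational composite S ∘ R := {(u,w) : ∃ v ∈ k^{2b}, (u,v) ∈ R and (v,w) ∈ S} is a coisotropic subspace of (k^{2a} × k^{2c}, Ω_{a,c}). (This is the well-definedness of composition in the prop of coisotropic relations CoIsot Rel_k.) -/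
open Matrix

/-- Points of `k^{2n} = k^n × k^n`, written as pairs `(z, x)` of a Z-grading
and an X-grading. -/
abbrev PVec (k : Type*) (n : ℕ) := (Fin n → k) × (Fin n → k)

/-- The standard symplectic form on `k^{2n}`:
`ω_n((z,x),(z',x')) = z·x' − x·z'`. -/
def stdForm {k : Type*} [Field k] (n : ℕ) (v w : PVec k n) : k :=
  v.1 ⬝ᵥ w.2 - v.2 ⬝ᵥ w.1

/-- The twisted symplectic form on `k^{2m} × k^{2n}`:
`Ω_{m,n}((u,v),(u',v')) = ω_n(v,v') − ω_m(u,u')`. -/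
def twForm {k : Type*} [Field k] (m n : ℕ) (p q : PVec k m × PVec k n) : k :=
  stdForm n p.2 q.2 - stdForm m p.1 q.1

/-- The symplectic complement of a set `S` with respect to a form `ω`. -/
def sympComplSet {k X : Type*} [Zero k] (ω : X → X → k) (S : Set X) : Set X :=
  {x | ∀ u ∈ S, ω x u = 0}

/-- A submodule is isotropic when it is contained in its symplectic complement. -/
def IsIsotropic {k X : Type*} [Field k] [AddCommGroup X] [Module k X]
    (ω : X → X → k) (U : Submodule k X) : Prop :=
  (U : Set X) ⊆ sympComplSet ω (U : Set X)

/-- A submodule is coisotropic when it contains its symplectic complement. -/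
def IsCoisotropic {k X : Type*} [Field k] [AddCommGroup X] [Module k X]
    (ω : X → X → k) (U : Submodule k X) : Prop :=
  sympComplSet ω (U : Set X) ⊆ (U : Set X)

/-- A submodule is Lagrangian when it equals its symplectic complement. -/
def IsLagrangian {k X : Type*} [Field k] [AddCommGroup X] [Module k X]
    (ω : X → X → k) (U : Submodule k X) : Prop :=
  (U : Set X) = sympComplSet ω (U : Set X)

/-- The composite of two linear relations, as a submodule. -/
def relComp {k U V W : Type*} [Semiring k] [AddCommMonoid U] [AddCommMonoid V] [AddCommMonoid W]
    [Module k U] [Module k V] [Module k W] (R : Submodule k (U × V)) (S : Submodule k (V × W)) :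
    Submodule k (U × W) where
  carrier := {p | ∃ v : V, (p.1, v) ∈ R ∧ (v, p.2) ∈ S}
  zero_mem' := ⟨0, R.zero_mem, S.zero_mem⟩
  add_mem' := by
    rintro p q ⟨v, hv, hv'⟩ ⟨w, hw, hw'⟩
    exact ⟨v + w, R.add_mem hv hw, S.add_mem hv' hw'⟩
  smul_mem' := by
    rintro t p ⟨v, hv, hv'⟩
    exact ⟨t • v, R.smul_mem t hv, S.smul_mem t hv'⟩

/-- The linear functional `ω_n(v, ·)`. -/
def stdFormRight {k : Type*} [Field k] (n : ℕ) (v : PVec k n) : PVec k n →ₗ[k] k where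
  toFun := stdForm n v
  map_add' x y := by simp only [stdForm, Prod.fst_add, Prod.snd_add, dotProduct_add]; ring
  map_smul' t x := by
    simp only [stdForm, Prod.smul_fst, Prod.smul_snd, dotProduct_smul, smul_eq_mul,
      RingHom.id_apply]
    ring

theorem stdFormRight_surjective {k : Type*} [Field k] (n : ℕ) :
    Function.Surjective (stdFormRight (k := k) n) := by
  intro φ
  obtain ⟨x, hx⟩ := (dotProductEquiv k (Fin n)).surjective (φ ∘ₗ LinearMap.inl k _ _)
  obtain ⟨z, hz⟩ := (dotProductEquiv k (Fin n)).surjective (φ ∘ₗ LinearMap.inr k _ _)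
  refine ⟨(z, -x), LinearMap.ext fun p => ?_⟩
  have h₁ : x ⬝ᵥ p.1 = φ (p.1, 0) := LinearMap.congr_fun hx p.1
  have h₂ : z ⬝ᵥ p.2 = φ (0, p.2) := LinearMap.congr_fun hz p.2
  change z ⬝ᵥ p.2 - (-x) ⬝ᵥ p.1 = φ p
  rw [neg_dotProduct, h₁, h₂, sub_neg_eq_add, ← map_add]
  simp

/-- A functional that vanishes on `U ⊓ ker g` is given on `U` by `ω_n(v, g ·)` for some `v`. -/
theorem exists_stdForm_eq_of_ker_le {k X : Type*} [Field k] [AddCommGroup X] [Module k X] {n : ℕ}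
    (U : Submodule k X) (g : X →ₗ[k] PVec k n) (f : X →ₗ[k] k)
    (h : ∀ x ∈ U, g x = 0 → f x = 0) :
    ∃ v : PVec k n, ∀ x ∈ U, f x = stdForm n v (g x) := by
  have hf : f.domRestrict U ∈ LinearMap.range (g.domRestrict U).dualMap := by
    rw [LinearMap.range_dualMap_eq_dualAnnihilator_ker, Submodule.mem_dualAnnihilator]
    exact fun x hx => h x x.2 hx
  obtain ⟨φ, hφ⟩ := hf
  obtain ⟨v, rfl⟩ := stdFormRight_surjective n φ
  exact ⟨v, fun x hx => (LinearMap.congr_fun hφ ⟨x, hx⟩).symm⟩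

/-- Coisotropic relations are closed under relational composition: the
composite of two coisotropic relations is again a coisotropic subspace. -/
theorem coisotropic_relations_comp {k : Type*} [Field k] (a b c : ℕ)
    (R : Submodule k (PVec k a × PVec k b))
    (S : Submodule k (PVec k b × PVec k c))
    (hR : IsCoisotropic (twForm a b) R)
    (hS : IsCoisotropic (twForm b c) S) :
    ∃ T : Submodule k (PVec k a × PVec k c),
      (T : Set (PVec k a × PVec k c)) =
        {p | ∃ v : PVec k b, (p.1, v) ∈ R ∧ (v, p.2) ∈ S} ∧
      IsCoisotropic (twForm a c) T := by
  refine ⟨relComp R S, rfl, ?_⟩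
  rintro ⟨u, w⟩ huw
  obtain ⟨v, hv⟩ := exists_stdForm_eq_of_ker_le (R.prod S)
    (LinearMap.snd k _ _ ∘ₗ LinearMap.fst k _ _ - LinearMap.fst k _ _ ∘ₗ LinearMap.snd k _ _)
    (stdFormRight a u ∘ₗ LinearMap.fst k _ _ ∘ₗ LinearMap.fst k _ _ -
      stdFormRight c w ∘ₗ LinearMap.snd k _ _ ∘ₗ LinearMap.snd k _ _) (by
      rintro ⟨⟨r, v⟩, v', s⟩ ⟨hr, hs⟩ h
      obtain rfl : v = v' := sub_eq_zero.1 h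
      have hT : stdForm c w s - stdForm a u r = 0 := huw (r, s) ⟨v, hr, hs⟩
      change stdForm a u r - stdForm c w s = 0
      rw [← neg_sub, hT, neg_zero])
  refine ⟨v, hR fun r hr => ?_, hS fun s hs => ?_⟩
  · have h : stdForm a u r.1 - stdForm c w 0 = stdForm b v (r.2 - 0) :=
      hv (r, 0) ⟨hr, S.zero_mem⟩
    simpa [twForm, stdForm, sub_eq_zero, eq_comm] using h
  · have h : stdForm a u 0 - stdForm c w s.2 = stdForm b v (0 - s.1) :=
      hv (0, s) ⟨R.zero_mem, hs⟩
    change stdForm c w s.2 - stdForm b v s.1 = 0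
    simp only [stdForm, Prod.fst_zero, Prod.snd_zero, dotProduct_zero, zero_sub, sub_zero,
      Prod.fst_neg, Prod.snd_neg, dotProduct_neg] at h ⊢
    linear_combination -h
end

section
/- The symplectic complement gives a composition-preserving bijection between coisotropic and isotropic relations: let k be a field and a, b, c ∈ ℕ. For a linear relation R ⊆ k^{2a} × k^{2b} let R^Ω denote its symplectic complement with respect to the twisted form Ω_{a,b}. Then: (i) if R is coisotropic for Ω_{a,b} then R^Ω is isotropic for Ω_{a,b}, and (R^Ω)^Ω = R, so (−)^Ω is a bijection between coisotropic and isotropic relations from k^{2a} to k^{2b}; and (ii) for all coisotropic relations R ⊆ k^{2a} × k^{2b} and S ⊆ k^{2b} × k^{2c}, (S ∘ R)^Ω = S^Ω ∘ R^Ω, where the complements on the right are taken with respect to Ω_{b,c} and Ω_{a,b} respectively and ∘ is relational composition. (This is the content of the claim that (−)^ω extends to an isomorphism of props CoIsot Rel_k ≅ Isot Rel_k.) -/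
open Matrix

theorem stdForm_antisymm {k : Type*} [Field k] {n : ℕ} (v w : PVec k n) :
    stdForm n v w = -stdForm n w v := by
  simp [stdForm, dotProduct_comm]

theorem twForm_antisymm {k : Type*} [Field k] {m n : ℕ} (p q : PVec k m × PVec k n) :
    twForm m n p q = -twForm m n q p := by
  simp only [twForm, stdForm_antisymm p.1 q.1, stdForm_antisymm p.2 q.2]
  ring

/-- The functional `ω_n(v, ·)`. -/
def stdFormDual {k : Type*} [Field k] {n : ℕ} (v : PVec k n) : Module.Dual k (PVec k n) where
  toFun := stdForm n v
  map_add' w w' := by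
    simp only [stdForm, Prod.fst_add, Prod.snd_add, dotProduct_add]
    ring
  map_smul' t w := by
    simp only [stdForm, Prod.smul_fst, Prod.smul_snd, dotProduct_smul, smul_eq_mul,
      RingHom.id_apply]
    ring

@[simp]
theorem stdFormDual_apply {k : Type*} [Field k] {n : ℕ} (v w : PVec k n) :
    stdFormDual v w = stdForm n v w := rfl

@[simp]
theorem stdForm_zero_right {k : Type*} [Field k] {n : ℕ} (v : PVec k n) : stdForm n v 0 = 0 :=
  map_zero (stdFormDual v)

/-- The standard symplectic form represents every linear functional. -/
theorem exists_stdForm_eq {k : Type*} [Field k] {n : ℕ} (f : Module.Dual k (PVec k n)) :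
    ∃ v : PVec k n, ∀ w, stdForm n v w = f w := by
  refine ⟨(fun i => f (0, Pi.single i 1), fun i => -f (Pi.single i 1, 0)), fun w => ?_⟩
  suffices h : stdFormDual (fun i => f (0, Pi.single i 1), fun i => -f (Pi.single i 1, 0)) = f from
    DFunLike.congr_fun h w
  ext i <;> simp [stdForm]

/-- The twisted symplectic form represents every linear functional. -/
theorem exists_twForm_eq {k : Type*} [Field k] {m n : ℕ}
    (f : Module.Dual k (PVec k m × PVec k n)) :
    ∃ p : PVec k m × PVec k n, ∀ q, twForm m n p q = f q := by
  obtain ⟨u, hu⟩ := exists_stdForm_eq (-(f ∘ₗ LinearMap.inl k _ _))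
  obtain ⟨v, hv⟩ := exists_stdForm_eq (f ∘ₗ LinearMap.inr k _ _)
  refine ⟨(u, v), fun q => ?_⟩
  rw [twForm, hu, hv, LinearMap.neg_apply, sub_neg_eq_add, LinearMap.comp_apply,
    LinearMap.comp_apply, ← map_add]
  simp

theorem sympComplSet_sympComplSet_twForm {k : Type*} [Field k] {m n : ℕ}
    (R : Submodule k (PVec k m × PVec k n)) :
    sympComplSet (twForm m n) (sympComplSet (twForm m n) (R : Set (PVec k m × PVec k n))) = R := by
  ext p
  refine ⟨fun hp => ?_, fun hp q hq => ?_⟩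
  · by_contra hpR
    obtain ⟨f, hfp, hfR⟩ := Submodule.exists_le_ker_of_notMem hpR
    obtain ⟨q, hq⟩ := exists_twForm_eq f
    apply hfp
    rw [← hq, twForm_antisymm, hp q fun r hr => (hq r).trans (hfR hr), neg_zero]
  · rw [twForm_antisymm, hq p hp, neg_zero]

theorem sympComplSet_twForm_comp {k : Type*} [Field k] {a b c : ℕ}
    (R : Submodule k (PVec k a × PVec k b)) (S : Submodule k (PVec k b × PVec k c)) :
    sympComplSet (twForm a c)
        {p : PVec k a × PVec k c | ∃ v : PVec k b, (p.1, v) ∈ R ∧ (v, p.2) ∈ S} =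
      {p : PVec k a × PVec k c |
        ∃ v : PVec k b,
          (p.1, v) ∈ sympComplSet (twForm a b) (R : Set (PVec k a × PVec k b)) ∧
          (v, p.2) ∈ sympComplSet (twForm b c) (S : Set (PVec k b × PVec k c))} := by
  ext ⟨u, w⟩
  constructor
  · intro h
    let φ : (R × S) →ₗ[k] PVec k b :=
      (LinearMap.snd k _ _ ∘ₗ R.subtype).coprod (-(LinearMap.fst k _ _ ∘ₗ S.subtype))
    let f : Module.Dual k (R × S) :=
      (stdFormDual u ∘ₗ LinearMap.fst k _ _ ∘ₗ R.subtype).coprod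
        (-(stdFormDual w ∘ₗ LinearMap.snd k _ _ ∘ₗ S.subtype))
    have hf : f ∈ (LinearMap.ker φ).dualAnnihilator := by
      rw [Submodule.mem_dualAnnihilator]
      rintro ⟨⟨⟨u', v₁⟩, hr⟩, ⟨⟨v₂, w'⟩, hs⟩⟩ hφ
      obtain rfl : v₁ = v₂ := by
        simpa [φ, ← sub_eq_add_neg, sub_eq_zero] using hφ
      have huw : stdForm c w w' - stdForm a u u' = 0 := h (u', w') ⟨v₁, hr, hs⟩
      simp [f, sub_eq_zero.mp huw]
    rw [← LinearMap.range_dualMap_eq_dualAnnihilator_ker] at hf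
    obtain ⟨g, hg⟩ := hf
    obtain ⟨v, hv⟩ := exists_stdForm_eq g
    refine ⟨v, fun r hr => ?_, fun s hs => ?_⟩
    · have := DFunLike.congr_fun hg (⟨r, hr⟩, 0)
      simp only [LinearMap.dualMap_apply] at this
      simpa [φ, f, twForm, sub_eq_zero, hv] using this
    · have := DFunLike.congr_fun hg (0, ⟨s, hs⟩)
      simp only [LinearMap.dualMap_apply] at this
      simpa [φ, f, twForm, sub_eq_zero, hv] using this.symm
  · rintro ⟨v, hR, hS⟩ ⟨u', w'⟩ ⟨v', hr, hs⟩
    have hR' : stdForm b v v' - stdForm a u u' = 0 := hR _ hr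
    have hS' : stdForm c w w' - stdForm b v v' = 0 := hS _ hs
    change stdForm c w w' - stdForm a u u' = 0
    linear_combination hR' + hS'

/-- The symplectic complement gives a composition-preserving bijection between
coisotropic and isotropic relations: on coisotropic relations it is an
involution landing in isotropic relations, and it preserves relational
composition. -/
theorem sympCompl_coisotropic_isotropic_bijection_comp {k : Type*} [Field k]
    (a b c : ℕ) :
    (∀ R : Submodule k (PVec k a × PVec k b),
      IsCoisotropic (twForm a b) R →
        (sympComplSet (twForm a b) (R : Set (PVec k a × PVec k b)) ⊆
          sympComplSet (twForm a b)
            (sympComplSet (twForm a b) (R : Set (PVec k a × PVec k b)))) ∧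
        sympComplSet (twForm a b)
            (sympComplSet (twForm a b) (R : Set (PVec k a × PVec k b))) =
          (R : Set (PVec k a × PVec k b))) ∧
    (∀ (R : Submodule k (PVec k a × PVec k b))
      (S : Submodule k (PVec k b × PVec k c)),
      IsCoisotropic (twForm a b) R → IsCoisotropic (twForm b c) S →
        sympComplSet (twForm a c)
            {p : PVec k a × PVec k c |
              ∃ v : PVec k b, (p.1, v) ∈ R ∧ (v, p.2) ∈ S} =
          {p : PVec k a × PVec k c |
            ∃ v : PVec k b,
              (p.1, v) ∈ sympComplSet (twForm a b) (R : Set (PVec k a × PVec k b)) ∧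
              (v, p.2) ∈ sympComplSet (twForm b c) (S : Set (PVec k b × PVec k c))}) := by
  refine ⟨fun R hR => ?_, fun R S _ _ => sympComplSet_twForm_comp R S⟩
  rw [sympComplSet_sympComplSet_twForm]
  exact ⟨hR, rfl⟩
end
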